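/- arXiv:1306.3909 — 9 statements merged into one kernel-verified Lean document; each statement's English description precedes it below -/
import Mathlib

section
/- Let F : (0, ∞) → ℝ be a function satisfying F(x) = 1 − F(1/x) for all x > 0, and for x, y > 0 define φ(x, y) = 1 + y − min{1, 1 − 1/x + y}·F(x) − y·F(y) + min{1 + 1/x, 1 + y}·F(x)·F(y). Then φ(x, y) = φ(1/y, 1/x) for all x, y > 0. -/
/-- The independent-tasks bound function
φ(x, y) = 1 + y − min{1, 1 − 1/x + y}·F(x) − y·F(y) + min{1 + 1/x, 1 + y}·F(x)·F(y). -/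
noncomputable def phiInd (F : ℝ → ℝ) (x y : ℝ) : ℝ :=
  1 + y - min 1 (1 - 1 / x + y) * F x - y * F y
    + min (1 + 1 / x) (1 + y) * (F x * F y)

/-- If F(x) = 1 − F(1/x) for all x > 0, then φ(x, y) = φ(1/y, 1/x) for all x, y > 0. -/
theorem phiInd_symm (F : ℝ → ℝ) (hF : ∀ x : ℝ, 0 < x → F x = 1 - F (1 / x)) :
    ∀ x y : ℝ, 0 < x → 0 < y → phiInd F x y = phiInd F (1 / y) (1 / x) := by
  intro x y hx hy
  have hx' : F (1 / x) = 1 - F x := by linarith [hF x hx]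
  have hy' : F (1 / y) = 1 - F y := by linarith [hF y hy]
  unfold phiInd
  rw [hx', hy', one_div_one_div]
  rcases le_total (1 / x) y with h | h
  · rw [min_eq_left (by linarith), min_eq_left (by linarith),
      min_eq_right (by linarith), min_eq_right (by linarith)]
    ring
  · rw [min_eq_right (by linarith), min_eq_right (by linarith),
      min_eq_left (by linarith), min_eq_left (by linarith)]
    ring
end

section
/- Let a = 1.715 and b = 0.76, and let F be the piecewise function defined by: F(x) = 1 for x ≥ a; F(x) = 1 − 2(1−b)(a−x)/(a−1) for (a+1)/2 ≤ x < a; F(x) = 1/2 + (2b−1)(x−1)/(a−1) for 1 ≤ x < (a+1)/2; F(x) = 1/2 − (2b−1)(1/x−1)/(a−1) for 2/(a+1) ≤ x < 1; F(x) = 2(1−b)(a−1/x)/(a−1) for 1/a ≤ x < 2/(a+1); F(x) = 0 for 0 ≤ x < 1/a. Then for all x, y > 0, φ(x, y) = 1 + y − min{1, 1 − 1/x + y}·F(x) − y·F(y) + min{1 + 1/x, 1 + y}·F(x)·F(y) satisfies φ(x, y) ≤ 1.58606. -/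
/-- The piecewise algebraic distribution function with parameters a = 1.715, b = 0.76. -/
noncomputable def Fpw (x : ℝ) : ℝ :=
  let a : ℝ := 1.715
  let b : ℝ := 0.76
  if x ≥ a then 1
  else if x ≥ (a + 1) / 2 then 1 - 2 * (1 - b) * (a - x) / (a - 1)
  else if x ≥ 1 then 1 / 2 + (2 * b - 1) * (x - 1) / (a - 1)
  else if x ≥ 2 / (a + 1) then 1 / 2 - (2 * b - 1) * (1 / x - 1) / (a - 1)
  else if x ≥ 1 / a then 2 * (1 - b) * (a - 1 / x) / (a - 1)
  else 0

theorem Fpw_of_ge_upper {x : ℝ} (h : 343 / 200 ≤ x) : Fpw x = 1 := by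
  unfold Fpw
  simp only
  rw [if_pos (by norm_num; linarith)]

theorem Fpw_of_upper_outer {x : ℝ} (h1 : 543 / 400 ≤ x) (h2 : x ≤ 343 / 200) :
    Fpw x = 1 - 96 / 143 * (343 / 200 - x) := by
  unfold Fpw
  simp only
  split_ifs <;> norm_num at * <;> linarith

theorem Fpw_of_upper_inner {x : ℝ} (h1 : 1 ≤ x) (h2 : x ≤ 543 / 400) :
    Fpw x = 1 / 2 + 8 / 11 * (x - 1) := by
  unfold Fpw
  simp only
  split_ifs <;> norm_num at * <;> linarith

theorem Fpw_of_lt_lower {x : ℝ} (h : x < 200 / 343) : Fpw x = 0 := by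
  unfold Fpw
  simp only
  split_ifs <;> norm_num at * <;> linarith

theorem Fpw_of_lower_outer {x : ℝ} (h1 : 200 / 343 ≤ x) (h2 : x < 400 / 543) :
    Fpw x = 96 / 143 * (343 / 200 - 1 / x) := by
  unfold Fpw
  simp only
  split_ifs <;> norm_num at * <;> linarith

theorem Fpw_of_lower_inner {x : ℝ} (h1 : 400 / 543 ≤ x) (h2 : x < 1) :
    Fpw x = 1 / 2 - 8 / 11 * (1 / x - 1) := by
  unfold Fpw
  simp only
  split_ifs <;> norm_num at * <;> linarith

theorem Fpw_one_div_of_one_lt {x : ℝ} (hx : 1 < x) : Fpw (1 / x) = 1 - Fpw x := by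
  have h0 : 0 < x := by linarith
  have inv : 1 / (1 / x) = x := one_div_one_div x
  have lt1 : 1 / x < 1 := by rw [div_lt_one h0]; exact hx
  rcases lt_or_ge (343 / 200) x with h | h
  · rw [Fpw_of_ge_upper h.le, Fpw_of_lt_lower (by rw [div_lt_iff₀ h0]; linarith)]; norm_num
  rcases lt_or_ge (543 / 400) x with h' | h'
  · rw [Fpw_of_upper_outer h'.le h, Fpw_of_lower_outer (by rw [le_div_iff₀ h0]; linarith)
      (by rw [div_lt_iff₀ h0]; linarith), inv]
    ring
  · rw [Fpw_of_upper_inner hx.le h', Fpw_of_lower_inner (by rw [le_div_iff₀ h0]; linarith) lt1, inv]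
    ring

theorem Fpw_one_div {x : ℝ} (hx : 0 < x) : Fpw (1 / x) = 1 - Fpw x := by
  rcases lt_trichotomy x 1 with h | rfl | h
  · have := Fpw_one_div_of_one_lt (x := 1 / x) (by rwa [lt_div_iff₀ hx, one_mul])
    rw [one_div_one_div] at this
    linarith
  · have : Fpw 1 = 1 / 2 := by rw [Fpw_of_upper_inner le_rfl (by norm_num)]; norm_num
    rw [one_div_one, this]; norm_num
  · exact Fpw_one_div_of_one_lt h

theorem Fpw_mem_of_one_le {x : ℝ} (hx : 1 ≤ x) : 1 / 2 ≤ Fpw x ∧ Fpw x ≤ 1 := by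
  rcases le_total (343 / 200) x with h | h
  · rw [Fpw_of_ge_upper h]; norm_num
  rcases le_total (543 / 400) x with h' | h'
  · rw [Fpw_of_upper_outer h' h]; constructor <;> linarith
  · rw [Fpw_of_upper_inner hx h']; constructor <;> linarith

/-- Maximising over `y` a concave quadratic arising from a branch `h + β * y` of `Fpw`. -/
theorem quadratic_branch_bound {h β C G u y : ℝ} (hβ : 0 < β)
    (hq : (1 - h + β * (G * (1 + u))) ^ 2 ≤ 4 * β * (C - (1 - G) - h * (G * (1 + u)))) :
    1 + y - G - y * (h + β * y) + (1 + u) * (G * (h + β * y)) ≤ C := by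
  have := sq_nonneg (2 * β * y - (1 - h + β * (G * (1 + u))))
  have h4 : 0 ≤ 4 * β * (C - (1 + y - G - y * (h + β * y) + (1 + u) * (G * (h + β * y)))) := by
    linarith
  have := nonneg_of_mul_nonneg_right h4 (by linarith)
  linarith

/-- The two increasing branches of `Fpw` on `[1, 1.715]`, as pairs (intercept, slope). -/
def IsUpperBranch (h β : ℝ) : Prop :=
  (h = -5 / 22 ∧ β = 8 / 11) ∨ (h = 1 - 96 / 143 * (343 / 200) ∧ β = 96 / 143)

/-- Bernstein products on an interval are nonnegative. -/
theorem pow_sub_mul_pow_sub_nonneg {lo hi t : ℝ} (h1 : lo ≤ t) (h2 : t ≤ hi) (i j : ℕ) :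
    0 ≤ (t - lo) ^ i * (hi - t) ^ j :=
  mul_nonneg (pow_nonneg (sub_nonneg.2 h1) i) (pow_nonneg (sub_nonneg.2 h2) j)

theorem upper_branch_bound {x h β : ℝ} (hx : 0 < x) (hb : IsUpperBranch h β) (hxa : 200 / 343 ≤ x) :
    (1 - h + β * (Fpw x * (1 + 1 / x))) ^ 2 ≤
      4 * β * (1.58606 - (1 - Fpw x) - h * (Fpw x * (1 + 1 / x))) := by
  have hu : 0 < 1 / x := by positivity
  have hxu : x * (1 / x) = 1 := by field_simp
  rcases lt_or_ge x (400 / 543) with h1 | h1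
  · rw [Fpw_of_lower_outer hxa h1]
    have l1 : 543 / 400 ≤ 1 / x := by rw [le_div_iff₀ hx]; linarith
    have l2 : 1 / x ≤ 343 / 200 := by rw [div_le_iff₀ hx]; linarith
    generalize 1 / x = u at *
    have B := pow_sub_mul_pow_sub_nonneg l1 l2
    rcases hb with ⟨rfl, rfl⟩ | ⟨rfl, rfl⟩ <;>
      linarith [B 0 4, B 1 3, B 2 2, B 3 1, B 4 0]
  rcases lt_or_ge x 1 with h2 | h2
  · rw [Fpw_of_lower_inner h1 h2]
    have l1 : 1 ≤ 1 / x := by rw [le_div_iff₀ hx]; linarith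
    have l2 : 1 / x ≤ 543 / 400 := by rw [div_le_iff₀ hx]; linarith
    generalize 1 / x = u at *
    have B := pow_sub_mul_pow_sub_nonneg l1 l2
    rcases hb with ⟨rfl, rfl⟩ | ⟨rfl, rfl⟩
    · linarith [B 0 4, B 1 3, B 2 2, B 3 1, B 4 0,
        mul_nonneg (B 0 1) (sq_nonneg (u - 1.01519)), mul_nonneg (B 1 0) (sq_nonneg (u - 1.01519)),
        mul_nonneg (B 1 1) (sq_nonneg (u - 1.01519))]
    · linarith [B 0 4, B 1 3, B 2 2, B 3 1, B 4 0]
  have e1 : x * (1 / x) ^ 2 = 1 / x := by field_simp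
  have e2 : x ^ 2 * (1 / x) ^ 2 = 1 := by field_simp
  have e3 : x ^ 3 * (1 / x) ^ 2 = x := by field_simp
  have e4 : x ^ 4 * (1 / x) ^ 2 = x ^ 2 := by field_simp
  have e5 : x ^ 2 * (1 / x) = x := by field_simp
  rcases le_total x (543 / 400) with h3 | h3
  · rw [Fpw_of_upper_inner h2 h3]
    generalize 1 / x = u at *
    have B := fun i j => mul_nonneg (pow_sub_mul_pow_sub_nonneg h2 h3 i j) (sq_nonneg u)
    rcases hb with ⟨rfl, rfl⟩ | ⟨rfl, rfl⟩ <;>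
      linarith [B 0 4, B 1 3, B 2 2, B 3 1, B 4 0]
  rcases le_total x (343 / 200) with h4 | h4
  · rw [Fpw_of_upper_outer h3 h4]
    generalize 1 / x = u at *
    have B := fun i j => mul_nonneg (pow_sub_mul_pow_sub_nonneg h3 h4 i j) (sq_nonneg u)
    rcases hb with ⟨rfl, rfl⟩ | ⟨rfl, rfl⟩ <;>
      linarith [B 0 4, B 1 3, B 2 2, B 3 1, B 4 0]
  rw [Fpw_of_ge_upper h4]
  have : 1 / x ≤ 200 / 343 := by rw [div_le_iff₀ hx]; linarith
  generalize 1 / x = u at *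
  rcases hb with ⟨rfl, rfl⟩ | ⟨rfl, rfl⟩ <;> nlinarith

theorem Fpw_mul_one_div_le {x : ℝ} (hx : 0 < x) : Fpw x * (1 / x) ≤ 0.58606 := by
  have hu : 0 < 1 / x := by positivity
  rcases lt_or_ge x (200 / 343) with h0 | h0
  · rw [Fpw_of_lt_lower h0]; norm_num
  rcases lt_or_ge x (400 / 543) with h1 | h1
  · rw [Fpw_of_lower_outer h0 h1]
    nlinarith [sq_nonneg (1 / x - 343 / 400)]
  rcases lt_or_ge x 1 with h2 | h2
  · rw [Fpw_of_lower_inner h1 h2]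
    nlinarith [sq_nonneg (1 / x - 27 / 32)]
  rw [mul_one_div, div_le_iff₀ hx]
  rcases le_total x (543 / 400) with h3 | h3
  · rw [Fpw_of_upper_inner h2 h3]; linarith
  rcases le_total x (343 / 200) with h4 | h4
  · rw [Fpw_of_upper_outer h3 h4]; linarith
  rw [Fpw_of_ge_upper h4]; linarith

theorem phi_le_of_one_le_mul {x y : ℝ} (hx : 0 < x) (hy : 0 < y) (hxy : 1 ≤ x * y) :
    1 + y - Fpw x - y * Fpw y + (1 + 1 / x) * (Fpw x * Fpw y) ≤ 1.58606 := by
  have hu : 1 / x ≤ y := by rw [div_le_iff₀ hx]; linarith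
  have hu0 : 0 < 1 / x := by positivity
  rcases lt_or_ge y 1 with hy1 | hy1
  · have hx1 : 1 ≤ x := by nlinarith
    obtain ⟨hG1, hG2⟩ := Fpw_mem_of_one_le hx1
    have hH := Fpw_one_div hy
    obtain ⟨hH1, hH2⟩ := Fpw_mem_of_one_le (x := 1 / y) (by rw [le_div_iff₀ hy]; linarith)
    rw [hH] at hH1 hH2
    have hp : Fpw x * (1 + 1 / x) ≤ Fpw x * 2 :=
      mul_le_mul_of_nonneg_left (by linarith) (by linarith)
    rcases le_total (Fpw x * (1 + 1 / x)) y with h | h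
    · nlinarith
    · nlinarith
  rcases le_total (343 / 200) y with hya | hya
  · rw [Fpw_of_ge_upper hya]
    have := Fpw_mul_one_div_le hx
    linarith
  have hxa : 200 / 343 ≤ x := by nlinarith
  rcases le_total (543 / 400) y with hym | hym
  · have := quadratic_branch_bound (y := y) (by norm_num)
      (upper_branch_bound hx (Or.inr ⟨rfl, rfl⟩) hxa)
    rw [Fpw_of_upper_outer hym hya]
    linarith
  · have := quadratic_branch_bound (y := y) (by norm_num)
      (upper_branch_bound hx (Or.inl ⟨rfl, rfl⟩) hxa)
    rw [Fpw_of_upper_inner hy1 hym]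
    linarith

/-- With this F, the independent-tasks bound function φ is at most 1.58606. -/
theorem phi_le_ratio :
    ∀ x y : ℝ, 0 < x → 0 < y →
      1 + y - min 1 (1 - 1 / x + y) * Fpw x - y * Fpw y
          + min (1 + 1 / x) (1 + y) * (Fpw x * Fpw y) ≤ 1.58606 := by
  intro x y hx hy
  rcases le_total (1 / x) y with h | h
  · rw [min_eq_left (by linarith), min_eq_left (by linarith), one_mul]
    exact phi_le_of_one_le_mul hx hy (by rw [div_le_iff₀ hx] at h; linarith)
  · rw [min_eq_right (by linarith), min_eq_right (by linarith)]
    have hyx : 1 ≤ 1 / y * (1 / x) := by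
      rw [le_div_iff₀ hx] at h
      rw [one_div_mul_one_div, le_div_iff₀ (by positivity)]
      linarith
    have := phi_le_of_one_le_mul (x := 1 / y) (y := 1 / x) (by positivity) (by positivity) hyx
    rw [Fpw_one_div hx, Fpw_one_div hy, one_div_one_div] at this
    linarith
end

section
/- Let F : [0, ∞) → [0, 1] be any nondecreasing function with F(0) = 0 and lim_{x→∞} F(x) = 1, and for x, y > 0 define φ(x, y) = 1 + y − min{1, 1 − 1/x + y}·F(x) − y·F(y) + min{1 + 1/x, 1 + y}·F(x)·F(y). Then there exist x, y > 0 with φ(x, y) ≥ 1.5852. -/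
/-- The bound function `φ` on the region `x * y ≤ 1`, written in terms of `a = F x` and `b = F y`. -/
noncomputable def phiLower (x y a b : ℝ) : ℝ :=
  1 + y - (1 - 1 / x + y) * a - y * b + (1 + y) * (a * b)

/-- No four nondecreasing values in `[0, 1 / 2]`, placed at `7 / 11`, `2 / 3`, `3 / 4` and `1`,
keep `phiLower` below `1.5852` along the chain of consecutive points. -/
theorem not_phiLower_chain_lt {a b c d : ℝ} (ha : 0 ≤ a) (hab : a ≤ b) (hbc : b ≤ c)
    (hcd : c ≤ d) (hd : d ≤ 1 / 2)
    (haa : phiLower (7 / 11) (7 / 11) a a < 1.5852)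
    (hφab : phiLower (7 / 11) (2 / 3) a b < 1.5852)
    (hφbc : phiLower (2 / 3) (3 / 4) b c < 1.5852)
    (hφcd : phiLower (3 / 4) 1 c d < 1.5852) : False := by
  unfold phiLower at haa hφab hφbc hφcd
  norm_num at haa hφab hφbc hφcd
  have a_ge : 0.093 ≤ a := by
    by_contra! h
    nlinarith
  have b_ge : 0.1415 ≤ b := by
    by_contra! h
    nlinarith [mul_nonneg (sub_nonneg.2 a_ge) (sub_nonneg.2 h.le)]
  have c_ge : 0.257 ≤ c := by
    by_contra! h
    nlinarith [mul_nonneg (sub_nonneg.2 b_ge) (sub_nonneg.2 h.le)]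
  nlinarith [mul_nonneg (sub_nonneg.2 c_ge) (sub_nonneg.2 hd)]


/-- For any nondecreasing F : [0, ∞) → [0, 1] with F(0) = 0 and F(x) → 1 as x → ∞,
the independent-tasks bound function φ attains a value at least 1.5852 somewhere. -/
theorem phi_lower_bound (F : ℝ → ℝ)
    (hmono : ∀ x y : ℝ, 0 ≤ x → x ≤ y → F x ≤ F y)
    (hrange : ∀ x : ℝ, 0 ≤ x → F x ∈ Set.Icc (0 : ℝ) 1)
    (h0 : F 0 = 0)
    (hlim : Filter.Tendsto F Filter.atTop (nhds 1)) :
    ∃ x y : ℝ, 0 < x ∧ 0 < y ∧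
      1 + y - min 1 (1 - 1 / x + y) * F x - y * F y
          + min (1 + 1 / x) (1 + y) * (F x * F y) ≥ 1.5852 := by
  by_contra! hlt
  have lower : ∀ x y : ℝ, 0 < x → 0 < y → x * y ≤ 1 → phiLower x y (F x) (F y) < 1.5852 := by
    intro x y hx hy hxy
    have hyx : y ≤ 1 / x := by rw [le_div_iff₀ hx]; linarith
    have h := hlt x y hx hy
    rwa [min_eq_right (by linarith : 1 - 1 / x + y ≤ 1),
      min_eq_right (by linarith : 1 + y ≤ 1 + 1 / x)] at h
  -- The symmetry `F ↦ 1 - F`, `(x, y) ↦ (1 / y, 1 / x)` exchanges the regions `x * y ≤ 1` and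
  -- `1 ≤ x * y`.
  have upper : ∀ x y : ℝ, 0 < x → 0 < y → x * y ≤ 1 →
      phiLower x y (1 - F (1 / x)) (1 - F (1 / y)) < 1.5852 := by
    intro x y hx hy hxy
    have hyx : y ≤ 1 / x := by rw [le_div_iff₀ hx]; linarith
    have h := hlt (1 / y) (1 / x) (by positivity) (by positivity)
    rw [one_div_one_div, min_eq_left (by linarith : 1 ≤ 1 - y + 1 / x),
      min_eq_left (by linarith : 1 + y ≤ 1 + 1 / x)] at h
    unfold phiLower
    linarith
  rcases le_total (F 1) (1 / 2) with h1 | h1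
  · exact not_phiLower_chain_lt (hrange (7 / 11) (by norm_num)).1
      (hmono (7 / 11) (2 / 3) (by norm_num) (by norm_num))
      (hmono (2 / 3) (3 / 4) (by norm_num) (by norm_num))
      (hmono (3 / 4) 1 (by norm_num) (by norm_num)) h1
      (lower _ _ (by norm_num) (by norm_num) (by norm_num))
      (lower _ _ (by norm_num) (by norm_num) (by norm_num))
      (lower _ _ (by norm_num) (by norm_num) (by norm_num))
      (lower _ _ (by norm_num) (by norm_num) (by norm_num))
  · exact not_phiLower_chain_lt
      (sub_nonneg.2 (hrange (1 / (7 / 11)) (by norm_num)).2)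
      (sub_le_sub_left (hmono (1 / (2 / 3)) (1 / (7 / 11)) (by norm_num) (by norm_num)) 1)
      (sub_le_sub_left (hmono (1 / (3 / 4)) (1 / (2 / 3)) (by norm_num) (by norm_num)) 1)
      (sub_le_sub_left (hmono (1 / 1) (1 / (3 / 4)) (by norm_num) (by norm_num)) 1)
      (by rw [one_div_one]; linarith)
      (upper _ _ (by norm_num) (by norm_num) (by norm_num))
      (upper _ _ (by norm_num) (by norm_num) (by norm_num))
      (upper _ _ (by norm_num) (by norm_num) (by norm_num))
      (upper _ _ (by norm_num) (by norm_num) (by norm_num))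
end

section
/- Let F : (0, ∞) → [0, 1] be a nondecreasing function satisfying F(x) + F(1/x) = 1 for all x > 0, and for x, y > 0 define φ(x, y) = 1 + y − min{1, 1 − 1/x + y}·F(x) − y·F(y) + min{1 + 1/x, 1 + y}·max{F(x) + F(y) − 1, 0}. Then φ(x, y) = φ(1/y, 1/x) for all x, y > 0. -/
/-- The two-task Clayton-Copula bound function. -/
noncomputable def phiCop (F : ℝ → ℝ) (x y : ℝ) : ℝ :=
  1 + y - min 1 (1 - 1 / x + y) * F x - y * F y
    + min (1 + 1 / x) (1 + y) * max (F x + F y - 1) 0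

/-- If F : (0, ∞) → [0, 1] is nondecreasing with F(x) + F(1/x) = 1 for all x > 0,
then φ(x, y) = φ(1/y, 1/x) for all x, y > 0. -/
theorem phiCop_symm (F : ℝ → ℝ)
    (hmono : ∀ x y : ℝ, 0 < x → x ≤ y → F x ≤ F y)
    (hrange : ∀ x : ℝ, 0 < x → F x ∈ Set.Icc (0 : ℝ) 1)
    (hsymm : ∀ x : ℝ, 0 < x → F x + F (1 / x) = 1) :
    ∀ x y : ℝ, 0 < x → 0 < y → phiCop F x y = phiCop F (1 / y) (1 / x) := by
  intro x y hx hy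
  have hFx : F (1 / x) = 1 - F x := by linarith [hsymm x hx]
  have hFy : F (1 / y) = 1 - F y := by linarith [hsymm y hy]
  unfold phiCop
  rw [hFx, hFy, one_div_one_div]
  generalize 1 / x = u
  have hmax : max (1 - F y + (1 - F x) - 1) 0 = max (F x + F y - 1) 0 - (F x + F y - 1) := by
    rw [← max_sub_sub_right, sub_self, max_comm]
    congr 1
    ring
  rw [hmax]
  rcases le_total y u with h | h
  · rw [min_eq_right (by linarith : 1 - u + y ≤ 1), min_eq_left (by linarith : 1 ≤ 1 - y + u),
      min_eq_right (by linarith : 1 + y ≤ 1 + u), min_eq_left (by linarith : 1 + y ≤ 1 + u)]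
    ring
  · rw [min_eq_left (by linarith : 1 ≤ 1 - u + y), min_eq_right (by linarith : 1 - y + u ≤ 1),
      min_eq_left (by linarith : 1 + u ≤ 1 + y), min_eq_right (by linarith : 1 + u ≤ 1 + y)]
    ring
end

section
/- Let a = 2.2468 and b = 0.7607, and let F be the piecewise function defined by: F(x) = 1 for x ≥ a; F(x) = 1 − 2(1−b)(a−x)/(a−1) for (a+1)/2 ≤ x < a; F(x) = 1/2 + (2b−1)(x−1)/(a−1) for 1 ≤ x < (a+1)/2; F(x) = 1/2 − (2b−1)(1/x−1)/(a−1) for 2/(a+1) ≤ x < 1; F(x) = 2(1−b)(a−1/x)/(a−1) for 1/a ≤ x < 2/(a+1); F(x) = 0 for 0 ≤ x < 1/a. Then for all x, y > 0, φ(x, y) = 1 + y − min{1, 1 − 1/x + y}·F(x) − y·F(y) + min{1 + 1/x, 1 + y}·max{F(x) + F(y) − 1, 0} satisfies φ(x, y) ≤ 1.5067711. -/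
/-- The piecewise algebraic distribution function with parameters a = 2.2468, b = 0.7607. -/
noncomputable def Fpw2 (x : ℝ) : ℝ :=
  let a : ℝ := 2.2468
  let b : ℝ := 0.7607
  if x ≥ a then 1
  else if x ≥ (a + 1) / 2 then 1 - 2 * (1 - b) * (a - x) / (a - 1)
  else if x ≥ 1 then 1 / 2 + (2 * b - 1) * (x - 1) / (a - 1)
  else if x ≥ 2 / (a + 1) then 1 / 2 - (2 * b - 1) * (1 / x - 1) / (a - 1)
  else if x ≥ 1 / a then 2 * (1 - b) * (a - 1 / x) / (a - 1)
  else 0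

lemma Fpw2_of_ge {x : ℝ} (h : 2.2468 ≤ x) : Fpw2 x = 1 := by
  simp [Fpw2, h]

lemma Fpw2_upper {x : ℝ} (h₁ : 1.6234 ≤ x) (h₂ : x < 2.2468) :
    Fpw2 x = 1 - 0.4786 / 1.2468 * (2.2468 - x) := by
  unfold Fpw2
  norm_num at *
  rw [if_neg (by linarith), if_pos (by linarith)]
  ring

lemma Fpw2_middle {x : ℝ} (h₁ : 1 ≤ x) (h₂ : x < 1.6234) :
    Fpw2 x = 1 / 2 + 0.5214 / 1.2468 * (x - 1) := by
  unfold Fpw2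
  norm_num at *
  rw [if_neg (by linarith), if_neg (by linarith), if_pos (by linarith)]
  ring

lemma Fpw2_one_div_of_one_lt {x : ℝ} (h : 1 < x) : Fpw2 (1 / x) = 1 - Fpw2 x := by
  have hx : 0 < x := by linarith
  have h1 : 1 / x < 1 := by rw [div_lt_one hx]; exact h
  have h2 : (1 / x ≥ (2 : ℝ) / (2.2468 + 1)) ↔ x ≤ 1.6234 := by
    rw [ge_iff_le, div_le_div_iff₀ (by norm_num) hx]
    constructor <;> intro h' <;> linarith
  have h3 : (1 / x ≥ (1 : ℝ) / 2.2468) ↔ x ≤ 2.2468 := by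
    rw [ge_iff_le, div_le_div_iff₀ (by norm_num) hx]
    constructor <;> intro h' <;> linarith
  unfold Fpw2
  simp only [h2, h3, one_div_one_div]
  rw [if_neg (by linarith), if_neg (by linarith), if_neg (by linarith)]
  norm_num only
  split_ifs <;> linarith

lemma Fpw2_one : Fpw2 1 = 1 / 2 := by
  rw [Fpw2_middle le_rfl (by norm_num)]
  norm_num

lemma Fpw2_one_div {x : ℝ} (hx : 0 < x) : Fpw2 (1 / x) = 1 - Fpw2 x := by
  rcases lt_trichotomy x 1 with h | rfl | h
  · have := Fpw2_one_div_of_one_lt (x := 1 / x) (by rw [lt_div_iff₀ hx]; linarith)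
    rw [one_div_one_div] at this
    linarith
  · norm_num [Fpw2_one]
  · exact Fpw2_one_div_of_one_lt h

lemma Fpw2_bounds_of_ge_one {x : ℝ} (h : 1 ≤ x) : 1 / 2 ≤ Fpw2 x ∧ Fpw2 x ≤ 1 := by
  rcases le_or_gt 2.2468 x with h1 | h1
  · rw [Fpw2_of_ge h1]; norm_num
  rcases le_or_gt 1.6234 x with h2 | h2
  · rw [Fpw2_upper h2 h1]; constructor <;> linarith
  · rw [Fpw2_middle h h2]; constructor <;> linarith

lemma Fpw2_bounds_of_le_one {x : ℝ} (hx : 0 < x) (h : x ≤ 1) : 0 ≤ Fpw2 x ∧ Fpw2 x ≤ 1 / 2 := by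
  have h1 := Fpw2_bounds_of_ge_one (x := 1 / x) (by rw [le_div_iff₀ hx]; linarith)
  rw [Fpw2_one_div hx] at h1
  constructor <;> linarith

lemma Fpw2_monotone : MonotoneOn Fpw2 (Set.Ioi 0) := by
  have key : ∀ x y : ℝ, 1 ≤ x → x ≤ y → Fpw2 x ≤ Fpw2 y := by
    intro x y hx hxy
    rcases le_or_gt 2.2468 y with h1 | h1
    · rw [Fpw2_of_ge h1]
      exact (Fpw2_bounds_of_ge_one hx).2
    rcases le_or_gt 1.6234 x with h2 | h2
    · rw [Fpw2_upper h2 (by linarith), Fpw2_upper (by linarith) h1]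
      linarith
    rw [Fpw2_middle hx h2]
    rcases le_or_gt 1.6234 y with h3 | h3
    · rw [Fpw2_upper h3 h1]; linarith
    · rw [Fpw2_middle (by linarith) h3]; linarith
  intro x hx y hy hxy
  rw [Set.mem_Ioi] at hx hy
  rcases le_or_gt 1 x with h1 | h1
  · exact key x y h1 hxy
  rcases le_or_gt 1 y with h2 | h2
  · linarith [(Fpw2_bounds_of_le_one hx h1.le).2, (Fpw2_bounds_of_ge_one h2).1]
  · have := key (1 / y) (1 / x) (by rw [le_div_iff₀ hy]; linarith)
      (one_div_le_one_div_of_le hx hxy)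
    rw [Fpw2_one_div hx, Fpw2_one_div hy] at this
    linarith

/-- Both branches of the bound function, according to whether `1 ≤ x * y`, have this form. -/
noncomputable def branch (t s : ℝ) : ℝ := s - t * Fpw2 t + Fpw2 s * (1 + t - s)

lemma mul_Fpw2_lower {t : ℝ} (h₀ : 0 < t) (h : t ≤ 1) :
    (t ≤ 1 / 2.2468 ∧ t * Fpw2 t = 0) ∨
    (1 / 2.2468 ≤ t ∧ t ≤ 1 / 1.6234 ∧ t * Fpw2 t = 0.4786 / 1.2468 * (2.2468 * t - 1)) ∨
    (1 / 1.6234 ≤ t ∧ t * Fpw2 t = t / 2 - 0.5214 / 1.2468 * (1 - t)) := by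
  have e : Fpw2 t = 1 - Fpw2 (1 / t) := by rw [Fpw2_one_div h₀]; ring
  have ht : t * (1 / t) = 1 := by field_simp
  have h1 : 1 ≤ 1 / t := by rw [le_div_iff₀ h₀]; linarith
  rcases le_or_gt 2.2468 (1 / t) with h2 | h2
  · left
    rw [e, Fpw2_of_ge h2]
    refine ⟨?_, by ring⟩
    rw [le_div_iff₀ (by norm_num)]
    nlinarith
  have h2' : 1 / 2.2468 ≤ t := by
    rw [div_le_iff₀ (by norm_num)]
    nlinarith
  right
  rcases le_or_gt 1.6234 (1 / t) with h3 | h3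
  · left
    rw [e, Fpw2_upper h3 h2]
    refine ⟨h2', ?_, by linear_combination (-0.4786 / 1.2468) * ht⟩
    rw [le_div_iff₀ (by norm_num)]
    nlinarith
  · right
    rw [e, Fpw2_middle h1 h3]
    refine ⟨?_, by linear_combination (-0.5214 / 1.2468) * ht⟩
    rw [div_le_iff₀ (by norm_num)]
    nlinarith

lemma branch_nodes {s : ℝ} (hs : 1 ≤ s) :
    s + Fpw2 s * (1 - s) ≤ 1.5067711 ∧
    s + Fpw2 s * (1 + 1 / 2.2468 - s) ≤ 1.5067711 ∧
    s - 0.2393 / 1.6234 + Fpw2 s * (1 + 1 / 1.6234 - s) ≤ 1.5067711 ∧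
    s - 1 / 2 + Fpw2 s * (2 - s) ≤ 1.5067711 := by
  rcases le_or_gt 2.2468 s with h1 | h1
  · rw [Fpw2_of_ge h1]
    norm_num
  rcases le_or_gt 1.6234 s with h2 | h2
  · rw [Fpw2_upper h2 h1]
    refine ⟨?_, ?_, ?_, ?_⟩
    · nlinarith [sq_nonneg (s - 3.2468 / 2)]
    · nlinarith [sq_nonneg (s - (3.2468 + 1 / 2.2468) / 2)]
    · nlinarith [sq_nonneg (s - (3.2468 + 1 / 1.6234) / 2)]
    · nlinarith [sq_nonneg (s - 4.2468 / 2)]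
  · rw [Fpw2_middle hs h2]
    refine ⟨?_, ?_, ?_, ?_⟩ <;>
      nlinarith [mul_nonneg (sub_nonneg.2 hs) (sub_nonneg.2 h2.le), sq_nonneg (s - 1.6234)]

lemma affine_le_of_endpoints {A B R t₀ t₁ t : ℝ} (h₀ : A + B * t₀ ≤ R) (h₁ : A + B * t₁ ≤ R)
    (ht₀ : t₀ ≤ t) (ht₁ : t ≤ t₁) : A + B * t ≤ R := by
  rcases le_total 0 B with hB | hB <;> nlinarith

lemma branch_le_of_le_one {t s : ℝ} (ht : 0 < t) (ht1 : t ≤ 1) (hs : 1 ≤ s) :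
    branch t s ≤ 1.5067711 := by
  obtain ⟨n0, n1, n2, n3⟩ := branch_nodes hs
  unfold branch
  generalize Fpw2 s = f at *
  rcases mul_Fpw2_lower ht ht1 with ⟨h1, h2⟩ | ⟨h1, h2, h3⟩ | ⟨h1, h2⟩
  · have := affine_le_of_endpoints (A := s + f * (1 - s)) (B := f) (R := 1.5067711)
      (t₀ := 0) (by linarith) (by linarith) ht.le h1
    rw [h2]
    linarith
  · have := affine_le_of_endpoints (A := s + f * (1 - s) + 0.4786 / 1.2468)
      (B := f - 0.4786 / 1.2468 * 2.2468) (R := 1.5067711) (by linarith) (by linarith) h1 h2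
    rw [h3]
    linarith
  · have := affine_le_of_endpoints (A := s + f * (1 - s) + 0.5214 / 1.2468)
      (B := f - 1 / 2 - 0.5214 / 1.2468) (R := 1.5067711) (by linarith) (by linarith) h1 ht1
    rw [h2]
    linarith

lemma branch_le_of_one_le {t s : ℝ} (ht : 1 ≤ t) (hts : t ≤ s) : branch t s ≤ 1.5067711 := by
  unfold branch
  rcases le_or_gt 1.6234 t with h1 | h1
  · have m : Fpw2 1.6234 ≤ Fpw2 t :=
      Fpw2_monotone (by norm_num [Set.mem_Ioi]) (Set.mem_Ioi.2 (by linarith)) h1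
    rw [Fpw2_upper (x := 1.6234) le_rfl (by norm_num)] at m
    have mts : Fpw2 t ≤ Fpw2 s :=
      Fpw2_monotone (Set.mem_Ioi.2 (by linarith)) (Set.mem_Ioi.2 (by linarith)) hts
    rcases le_or_gt 2.2468 s with h2 | h2
    · rw [Fpw2_of_ge h2]
      rcases le_or_gt 2.2468 t with h3 | h3
      · rw [Fpw2_of_ge h3]; linarith
      · rw [Fpw2_upper h1 h3]; nlinarith
    · rw [Fpw2_upper (by linarith) h2, Fpw2_upper h1 (by linarith)]
      nlinarith
  rw [Fpw2_middle ht h1]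
  rcases le_or_gt 2.2468 s with h2 | h2
  · rw [Fpw2_of_ge h2]
    nlinarith [sq_nonneg (t - 1.0978)]
  rcases le_or_gt 1.6234 s with h3 | h3
  · rw [Fpw2_upper h3 h2]
    nlinarith [sq_nonneg (s - (3.2468 + t) / 2), sq_nonneg (t - 1.05344)]
  · rw [Fpw2_middle (by linarith) h3]
    nlinarith [sq_nonneg (s - t), mul_nonneg (sub_nonneg.2 ht) (sub_nonneg.2 hts),
      mul_nonneg (sub_nonneg.2 ht) (sub_nonneg.2 h3.le)]

lemma branch_le {t s : ℝ} (ht : 0 < t) (hts : t ≤ s) : branch t s ≤ 1.5067711 := by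
  rcases le_or_gt 1 t with h1 | h1
  · exact branch_le_of_one_le h1 hts
  rcases le_or_gt 1 s with h2 | h2
  · exact branch_le_of_le_one ht h1.le h2
  · obtain ⟨b1, b2⟩ := Fpw2_bounds_of_le_one (ht.trans_le hts) h2.le
    have b3 := mul_nonneg ht.le (Fpw2_bounds_of_le_one ht h1.le).1
    unfold branch
    nlinarith

/-- With this F, the two-task Clayton-Copula bound function φ is at most 1.5067711. -/
theorem phiCop_le_ratio :
    ∀ x y : ℝ, 0 < x → 0 < y →
      1 + y - min 1 (1 - 1 / x + y) * Fpw2 x - y * Fpw2 y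
          + min (1 + 1 / x) (1 + y) * max (Fpw2 x + Fpw2 y - 1) 0 ≤ 1.5067711 := by
  intro x y hx hy
  have ht : 0 < 1 / x := one_div_pos.2 hx
  have e : Fpw2 x = 1 - Fpw2 (1 / x) := by rw [Fpw2_one_div hx]; ring
  rw [e]
  generalize 1 / x = t at *
  rcases le_total t y with h | h
  · have m : Fpw2 t ≤ Fpw2 y := Fpw2_monotone ht hy h
    rw [min_eq_left (by linarith), min_eq_left (by linarith), max_eq_left (by linarith)]
    have := branch_le ht h
    unfold branch at this
    linarith
  · have m : Fpw2 y ≤ Fpw2 t := Fpw2_monotone hy ht h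
    rw [min_eq_right (by linarith), min_eq_right (by linarith), max_eq_right (by linarith)]
    have := branch_le hy h
    unfold branch at this
    linarith
end

section
/- For all real numbers u, v ∈ [0, 1], the sequence indexed by integers n ≥ 2 given by (max{u^{1/(n−1)} + v^{1/(n−1)} − 1, 0})^{n−1} converges to u·v as n → ∞. -/
open Filter Topology

lemma tendsto_natCast_mul_rpow_one_div_sub_one {u : ℝ} (hu : 0 < u) :
    Tendsto (fun m : ℕ => (m : ℝ) * (u ^ ((1 : ℝ) / (m : ℝ)) - 1)) atTop (𝓝 (Real.log u)) := by
  have hd : HasDerivAt (fun x : ℝ => u ^ x) (Real.log u) 0 := by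
    simpa using (hasDerivAt_id (0 : ℝ)).const_rpow hu
  have h := hd.tendsto_slope_zero_right.comp
    (tendsto_inv_atTop_nhdsGT_zero.comp (tendsto_natCast_atTop_atTop (R := ℝ)))
  refine h.congr fun m => ?_
  simp

lemma tendsto_rpow_one_div_natCast {u : ℝ} (hu : 0 < u) :
    Tendsto (fun m : ℕ => u ^ ((1 : ℝ) / (m : ℝ))) atTop (𝓝 1) := by
  simpa using (tendsto_const_nhds (x := u)).rpow tendsto_one_div_atTop_nhds_zero_nat
    (Or.inl hu.ne')

lemma tendsto_max_rpow_add_rpow_sub_one_pow {u v : ℝ} (hu : 0 < u) (hv : 0 < v) :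
    Tendsto (fun m : ℕ =>
      (max (u ^ ((1 : ℝ) / (m : ℝ)) + v ^ ((1 : ℝ) / (m : ℝ)) - 1) 0) ^ m)
      atTop (𝓝 (u * v)) := by
  have hg : Tendsto (fun m : ℕ =>
      (m : ℝ) * (u ^ ((1 : ℝ) / (m : ℝ)) + v ^ ((1 : ℝ) / (m : ℝ)) - 2))
      atTop (𝓝 (Real.log u + Real.log v)) :=
    ((tendsto_natCast_mul_rpow_one_div_sub_one hu).add
      (tendsto_natCast_mul_rpow_one_div_sub_one hv)).congr fun m => by ring
  have hexp := Real.tendsto_one_add_pow_exp_of_tendsto hg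
  rw [Real.exp_add, Real.exp_log hu, Real.exp_log hv] at hexp
  have hone : Tendsto (fun m : ℕ => u ^ ((1 : ℝ) / (m : ℝ)) + v ^ ((1 : ℝ) / (m : ℝ)) - 1)
      atTop (𝓝 (1 + 1 - 1)) :=
    ((tendsto_rpow_one_div_natCast hu).add (tendsto_rpow_one_div_natCast hv)).sub_const 1
  refine hexp.congr' ?_
  filter_upwards [hone.eventually_const_lt (u := 0) (by norm_num)] with m hm
  rw [max_eq_left hm.le]
  congr 1
  ring

lemma tendsto_max_zero_rpow_add_rpow_sub_one_pow {v : ℝ} (hv : v ∈ Set.Icc (0 : ℝ) 1) :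
    Tendsto (fun m : ℕ =>
      (max ((0 : ℝ) ^ ((1 : ℝ) / (m : ℝ)) + v ^ ((1 : ℝ) / (m : ℝ)) - 1) 0) ^ m)
      atTop (𝓝 0) := by
  refine tendsto_const_nhds.congr' ?_
  filter_upwards [eventually_gt_atTop 0] with m hm
  have hm' : (0 : ℝ) < 1 / (m : ℝ) := by positivity
  have hle : v ^ ((1 : ℝ) / (m : ℝ)) ≤ 1 := Real.rpow_le_one hv.1 hv.2 hm'.le
  rw [Real.zero_rpow hm'.ne', max_eq_right (by linarith), zero_pow hm.ne']

/-- The bivariate Clayton Copula value converges to the independent product as n → ∞: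
for u, v ∈ [0, 1],
(max{u^{1/(n−1)} + v^{1/(n−1)} − 1, 0})^{n−1} → u·v. -/
theorem clayton_tendsto_prod (u v : ℝ)
    (hu : u ∈ Set.Icc (0 : ℝ) 1) (hv : v ∈ Set.Icc (0 : ℝ) 1) :
    Filter.Tendsto
      (fun n : ℕ =>
        (max (u ^ ((1 : ℝ) / ((n : ℝ) - 1)) + v ^ ((1 : ℝ) / ((n : ℝ) - 1)) - 1) 0) ^ (n - 1))
      Filter.atTop (nhds (u * v)) := by
  rw [← tendsto_add_atTop_iff_nat 1]
  simp only [Nat.cast_add, Nat.cast_one, add_sub_cancel_right, Nat.add_sub_cancel]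
  rcases hu.1.eq_or_lt with rfl | hu0
  · rw [zero_mul]
    exact tendsto_max_zero_rpow_add_rpow_sub_one_pow hv
  rcases hv.1.eq_or_lt with rfl | hv0
  · rw [mul_zero]
    exact (tendsto_max_zero_rpow_add_rpow_sub_one_pow hu).congr fun m => by
      rw [add_comm ((0 : ℝ) ^ ((1 : ℝ) / (m : ℝ)))]
  exact tendsto_max_rpow_add_rpow_sub_one_pow hu0 hv0
end

section
/- Let a ∈ [1.7, 3] and b ∈ [0.7, 1] be real constants, and let F : [0, ∞) → ℝ be the piecewise function defined by: F(x) = 1 for x ≥ a; F(x) = 1 − 2(1−b)(a−x)/(a−1) for (a+1)/2 ≤ x < a; F(x) = 1/2 + (2b−1)(x−1)/(a−1) for 1 ≤ x < (a+1)/2; F(x) = 1/2 − (2b−1)(1/x−1)/(a−1) for 2/(a+1) ≤ x < 1; F(x) = 2(1−b)(a−1/x)/(a−1) for 1/a ≤ x < 2/(a+1); F(x) = 0 for 0 ≤ x < 1/a. Then F is continuous on [0, ∞), nondecreasing, takes values in [0, 1], satisfies F(0) = 0 and F(x) = 1 for all x ≥ a, and satisfies F(x) + F(1/x) = 1 for all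 x > 0. -/
/-- The piecewise algebraic distribution function with general parameters a and b. -/
noncomputable def Fgen (a b x : ℝ) : ℝ :=
  if x ≥ a then 1
  else if x ≥ (a + 1) / 2 then 1 - 2 * (1 - b) * (a - x) / (a - 1)
  else if x ≥ 1 then 1 / 2 + (2 * b - 1) * (x - 1) / (a - 1)
  else if x ≥ 2 / (a + 1) then 1 / 2 - (2 * b - 1) * (1 / x - 1) / (a - 1)
  else if x ≥ 1 / a then 2 * (1 - b) * (a - 1 / x) / (a - 1)
  else 0

/-- The continuous nondecreasing function of `t` that vanishes for `t ≤ 1`, equals `1 / 2` for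
`a ≤ t`, and is affine on each of `[1, (a + 1) / 2]` and `[(a + 1) / 2, a]`. -/
noncomputable def upperExcess (a b t : ℝ) : ℝ :=
  (2 * b - 1) / (a - 1) * (max 1 (min t ((a + 1) / 2)) - 1) +
    2 * (1 - b) / (a - 1) * (max ((a + 1) / 2) (min t a) - (a + 1) / 2)

section upperExcess

variable {a b t : ℝ}

theorem continuous_upperExcess (a b : ℝ) : Continuous (upperExcess a b) := by
  unfold upperExcess
  fun_prop

theorem monotone_upperExcess (ha : 1 < a) (hb : 1 / 2 ≤ b) (hb' : b ≤ 1) :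
    Monotone (upperExcess a b) := by
  intro s t hst
  have h₁ : 0 ≤ (2 * b - 1) / (a - 1) := div_nonneg (by linarith) (by linarith)
  have h₂ : 0 ≤ 2 * (1 - b) / (a - 1) := div_nonneg (by linarith) (by linarith)
  unfold upperExcess
  gcongr

theorem upperExcess_of_le_one (ha : 1 < a) (ht : t ≤ 1) : upperExcess a b t = 0 := by
  unfold upperExcess
  rw [min_eq_left (by linarith), min_eq_left (by linarith), max_eq_left ht,
    max_eq_left (by linarith)]
  ring

theorem upperExcess_of_le_mid (ha : 1 < a) (ht : 1 ≤ t) (ht' : t ≤ (a + 1) / 2) :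
    upperExcess a b t = (2 * b - 1) * (t - 1) / (a - 1) := by
  unfold upperExcess
  rw [min_eq_left ht', min_eq_left (by linarith), max_eq_right ht, max_eq_left ht']
  ring

theorem upperExcess_of_mid_le (ha : 1 < a) (ht : (a + 1) / 2 ≤ t) (ht' : t ≤ a) :
    upperExcess a b t = 1 / 2 - 2 * (1 - b) * (a - t) / (a - 1) := by
  have : a - 1 ≠ 0 := by linarith
  unfold upperExcess
  rw [min_eq_right ht, min_eq_left ht', max_eq_right (by linarith), max_eq_right ht]
  field_simp
  ring

theorem upperExcess_of_le (ha : 1 < a) (ht : a ≤ t) : upperExcess a b t = 1 / 2 := by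
  have : a - 1 ≠ 0 := by linarith
  unfold upperExcess
  rw [min_eq_right (by linarith), min_eq_right ht, max_eq_right (by linarith),
    max_eq_right (by linarith)]
  field_simp
  ring

theorem Fgen_eq_of_pos {x : ℝ} (ha : 1 < a) (hx : 0 < x) :
    Fgen a b x = 1 / 2 + upperExcess a b x - upperExcess a b (1 / x) := by
  have inv_le_one (h : 1 ≤ x) : 1 / x ≤ 1 := (div_le_one hx).2 h
  unfold Fgen
  split_ifs with h₁ h₂ h₃ h₄ h₅
  · rw [upperExcess_of_le ha h₁, upperExcess_of_le_one ha (inv_le_one (by linarith))]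
    norm_num
  · rw [upperExcess_of_mid_le ha h₂ (by linarith),
      upperExcess_of_le_one ha (inv_le_one (by linarith))]
    ring
  · rw [upperExcess_of_le_mid ha h₃ (by linarith), upperExcess_of_le_one ha (inv_le_one h₃)]
    ring
  · have hle : 1 / x ≤ (a + 1) / 2 := by
      rw [ge_iff_le, div_le_iff₀ (by linarith)] at h₄
      rw [div_le_iff₀ hx]
      linarith
    rw [upperExcess_of_le_one ha (by linarith),
      upperExcess_of_le_mid ha ((one_le_div hx).2 (by linarith)) hle]
    ring
  · have hle : (a + 1) / 2 ≤ 1 / x := by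
      rw [not_le, lt_div_iff₀ (by linarith)] at h₄
      rw [le_div_iff₀ hx]
      linarith
    rw [upperExcess_of_le_one ha (by linarith),
      upperExcess_of_mid_le ha hle ((one_div_le hx (by linarith)).2 h₅)]
    ring
  · rw [upperExcess_of_le_one ha (by linarith),
      upperExcess_of_le ha ((le_one_div (by linarith) hx).2 (by linarith))]
    norm_num

theorem Fgen_of_lt_one_div {x : ℝ} (ha : 1 < a) (hx : x < 1 / a) : Fgen a b x = 0 := by
  have h₁ : 1 / a ≤ 2 / (a + 1) := by
    rw [div_le_div_iff₀ (by linarith) (by linarith)]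
    linarith
  have h₂ : 2 / (a + 1) ≤ 1 := (div_le_one (by linarith)).2 (by linarith)
  unfold Fgen
  rw [if_neg, if_neg, if_neg, if_neg, if_neg] <;> linarith

/-- Cutting the reciprocal off at `a` gives a formula without junk values, valid on all of `ℝ`. -/
theorem Fgen_eq (ha : 1 < a) (x : ℝ) :
    Fgen a b x = 1 / 2 + upperExcess a b x - upperExcess a b (1 / max x (1 / a)) := by
  have ha' : 0 < 1 / a := by positivity
  rcases le_or_gt (1 / a) x with h | h
  · rw [max_eq_left h, Fgen_eq_of_pos ha (ha'.trans_le h)]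
  · have : 1 / a < 1 := (div_lt_one (by linarith)).2 ha
    rw [max_eq_right h.le, one_div_one_div, Fgen_of_lt_one_div ha h,
      upperExcess_of_le_one ha (by linarith), upperExcess_of_le ha le_rfl]
    norm_num

theorem continuous_Fgen (ha : 1 < a) : Continuous (Fgen a b) := by
  rw [funext (Fgen_eq ha)]
  have hne (x : ℝ) : max x (1 / a) ≠ 0 :=
    (lt_max_of_lt_right (by positivity)).ne'
  have hk := continuous_upperExcess a b
  exact (continuous_const.add hk).sub (hk.comp (by fun_prop (disch := exact hne _)))

theorem monotone_Fgen (ha : 1 < a) (hb : 1 / 2 ≤ b) (hb' : b ≤ 1) : Monotone (Fgen a b) := by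
  intro x y hxy
  have hk := monotone_upperExcess ha hb hb'
  have hpos : 0 < max x (1 / a) := lt_max_of_lt_right (by positivity)
  rw [Fgen_eq ha, Fgen_eq ha]
  exact sub_le_sub (by linarith [hk hxy])
    (hk (one_div_le_one_div_of_le hpos (max_le_max_right _ hxy)))

end upperExcess

/-- For a ∈ [1.7, 3] and b ∈ [0.7, 1], the piecewise function F is continuous on [0, ∞),
nondecreasing, takes values in [0, 1] on [0, ∞), satisfies F(0) = 0, F(x) = 1 for x ≥ a,
and F(x) + F(1/x) = 1 for all x > 0. -/
theorem Fgen_is_valid_cdf (a b : ℝ)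
    (ha : a ∈ Set.Icc (1.7 : ℝ) 3) (hb : b ∈ Set.Icc (0.7 : ℝ) 1) :
    ContinuousOn (Fgen a b) (Set.Ici (0 : ℝ)) ∧
    (∀ x y : ℝ, 0 ≤ x → x ≤ y → Fgen a b x ≤ Fgen a b y) ∧
    (∀ x : ℝ, 0 ≤ x → Fgen a b x ∈ Set.Icc (0 : ℝ) 1) ∧
    Fgen a b 0 = 0 ∧
    (∀ x : ℝ, a ≤ x → Fgen a b x = 1) ∧
    (∀ x : ℝ, 0 < x → Fgen a b x + Fgen a b (1 / x) = 1) := by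
  have ha₁ : 1 < a := by linarith [ha.1]
  have hmono : Monotone (Fgen a b) := monotone_Fgen ha₁ (by linarith [hb.1]) hb.2
  have hzero : Fgen a b 0 = 0 := Fgen_of_lt_one_div ha₁ (by positivity)
  have hone (x : ℝ) (hx : a ≤ x) : Fgen a b x = 1 := if_pos hx
  refine ⟨(continuous_Fgen ha₁).continuousOn, fun x y _ hxy => hmono hxy,
    fun x hx => ⟨hzero ▸ hmono hx, ?_⟩, hzero, hone, fun x hx => ?_⟩
  · exact (hmono (le_max_left x a)).trans_eq (hone _ (le_max_right x a))
  · rw [Fgen_eq_of_pos ha₁ hx, Fgen_eq_of_pos ha₁ (one_div_pos.2 hx), one_div_one_div]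
    ring
end

section
/- Let F(x) = 1 − 2^{−x^{2.3}} for x ≥ 0, let α₁ = 0.87793459260323 and α₂ = 2.09409917605545, and set β₁ = F(α₁) and β₂ = F(1/α₂). Then θ = (1 + α₂)·β₁·β₂ + β₁·(1 − β₂) + (1 + α₁)·(1 − β₁)·(1 − β₂) + α₂·β₂·(1 − β₁) satisfies θ > 1.5963. -/
/-- Lu and Yu's distribution function F(x) = 1 − 2^{−x^{2.3}}. -/
noncomputable def FLY (x : ℝ) : ℝ := 1 - (2 : ℝ) ^ (-(x ^ (2.3 : ℝ)))

theorem rpow_exponent_pow_ten {x : ℝ} (hx : 0 ≤ x) : (x ^ (2.3 : ℝ)) ^ 10 = x ^ 23 := by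
  rw [← Real.rpow_mul_natCast hx, ← Real.rpow_natCast]
  norm_num

theorem FLY_le {x y t : ℝ} (n : ℕ) (hn : n ≠ 0) (hx : 0 ≤ x) (hy : 0 ≤ y)
    (hxy : x ^ 23 ≤ y ^ 10) (ht : t ^ n ≤ (2 : ℝ) ^ (-y * n)) : FLY x ≤ 1 - t := by
  have hpow : x ^ (2.3 : ℝ) ≤ y :=
    le_of_pow_le_pow_left₀ (n := 10) (by norm_num) hy (by rwa [rpow_exponent_pow_ten hx])
  have hroot : t ≤ (2 : ℝ) ^ (-y) :=
    le_of_pow_le_pow_left₀ hn (by positivity) (by rwa [← Real.rpow_mul_natCast zero_le_two])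
  have hmono : (2 : ℝ) ^ (-y) ≤ 2 ^ (-(x ^ (2.3 : ℝ))) :=
    Real.rpow_le_rpow_of_exponent_le one_le_two (neg_le_neg hpow)
  unfold FLY
  linarith

theorem le_FLY {x y t : ℝ} (n : ℕ) (hn : n ≠ 0) (hx : 0 ≤ x) (ht₀ : 0 ≤ t)
    (hxy : y ^ 10 ≤ x ^ 23) (ht : (2 : ℝ) ^ (-y * n) ≤ t ^ n) : 1 - t ≤ FLY x := by
  have hpow : y ≤ x ^ (2.3 : ℝ) :=
    le_of_pow_le_pow_left₀ (n := 10) (by norm_num) (by positivity) (by rwa [rpow_exponent_pow_ten hx])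
  have hroot : (2 : ℝ) ^ (-y) ≤ t :=
    le_of_pow_le_pow_left₀ hn ht₀ (by rwa [← Real.rpow_mul_natCast zero_le_two])
  have hmono : (2 : ℝ) ^ (-(x ^ (2.3 : ℝ))) ≤ 2 ^ (-y) :=
    Real.rpow_le_rpow_of_exponent_le one_le_two (neg_le_neg hpow)
  unfold FLY
  linarith

/-- Counterexample to Lu and Yu's claimed bound: for α₁ = 0.87793459260323,
α₂ = 2.09409917605545, β₁ = F(α₁), β₂ = F(1/α₂), the quantity
θ = (1+α₂)β₁β₂ + β₁(1−β₂) + (1+α₁)(1−β₁)(1−β₂) + α₂β₂(1−β₁) exceeds 1.5963. -/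
theorem luYu_counterexample :
    let α₁ : ℝ := 0.87793459260323
    let α₂ : ℝ := 2.09409917605545
    let β₁ : ℝ := FLY α₁
    let β₂ : ℝ := FLY (1 / α₂)
    (1 + α₂) * β₁ * β₂ + β₁ * (1 - β₂) + (1 + α₁) * (1 - β₁) * (1 - β₂)
        + α₂ * β₂ * (1 - β₁) > 1.5963 := by
  intro α₁ α₂ β₁ β₂
  have two_rpow_neg (k : ℕ) : (2 : ℝ) ^ (-(k : ℝ)) = (2 ^ k)⁻¹ := by
    rw [Real.rpow_neg zero_le_two, Real.rpow_natCast]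
  have hβ₁ : β₁ ≤ 1 - 0.594 := by
    refine FLY_le (y := 3 / 4) 4 (by norm_num) (by norm_num [α₁]) (by norm_num)
      (by norm_num [α₁]) ?_
    rw [show -(3 / 4 : ℝ) * (4 : ℕ) = -(3 : ℕ) by norm_num, two_rpow_neg]
    norm_num
  have hβ₂ : 1 - 0.891 ≤ β₂ := by
    refine le_FLY (y := 1 / 6) 6 (by norm_num) (by norm_num [α₂]) (by norm_num)
      (by norm_num [α₂]) ?_
    rw [show -(1 / 6 : ℝ) * (6 : ℕ) = -(1 : ℕ) by norm_num, two_rpow_neg]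
    norm_num
  have hβ₁_nonneg : 0 ≤ β₁ := by
    simpa using le_FLY (x := α₁) (y := 0) (t := 1) 1 one_ne_zero (by norm_num [α₁]) zero_le_one
      (by norm_num [α₁]) (by norm_num)
  have hprod := mul_nonneg hβ₁_nonneg (sub_nonneg.2 hβ₂)
  clear_value β₁ β₂
  simp only [α₁, α₂]
  linarith
end

section
/- Let a = 1.715 and b = 0.76, and let F be the piecewise function defined by: F(x) = 1 for x ≥ a; F(x) = 1 − 2(1−b)(a−x)/(a−1) for (a+1)/2 ≤ x < a; F(x) = 1/2 + (2b−1)(x−1)/(a−1) for 1 ≤ x < (a+1)/2; F(x) = 1/2 − (2b−1)(1/x−1)/(a−1) for 2/(a+1) ≤ x < 1; F(x) = 2(1−b)(a−1/x)/(a−1) for 1/a ≤ x < 2/(a+1); F(x) = 0 for 0 ≤ x < 1/a. Then the function x ↦ F(x)/x is nondecreasing on the interval [1/a, a]. -/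
theorem Fpw_eq_of_mem_Icc_mid_a {x : ℝ} (hx : x ∈ Set.Icc (2.715 / 2 : ℝ) 1.715) :
    Fpw x = 96 / 143 * x + -(541 / 3575) := by
  obtain ⟨h₁, h₂⟩ := hx
  simp only [Fpw, show (1.715 : ℝ) - 1 = 143 / 200 by norm_num]
  split_ifs <;> linarith

theorem Fpw_eq_of_mem_Icc_one_mid {x : ℝ} (hx : x ∈ Set.Icc (1 : ℝ) (2.715 / 2)) :
    Fpw x = 8 / 11 * x + -(5 / 22) := by
  obtain ⟨h₁, h₂⟩ := hx
  simp only [Fpw, show (1.715 : ℝ) - 1 = 143 / 200 by norm_num]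
  split_ifs <;> linarith

theorem Fpw_eq_of_mem_Icc_inv_mid_one {x : ℝ} (hx : x ∈ Set.Icc (2 / 2.715 : ℝ) 1) :
    Fpw x = 27 / 22 - 8 / 11 * x⁻¹ := by
  obtain ⟨h₁, h₂⟩ := hx
  obtain rfl | h₂ := h₂.eq_or_lt
  · norm_num [Fpw]
  · have h₃ : (2 : ℝ) / (1.715 + 1) ≤ x := by norm_num at h₁ ⊢; exact h₁
    simp only [Fpw, one_div, show (1.715 : ℝ) - 1 = 143 / 200 by norm_num]
    split_ifs <;> linarith

theorem Fpw_eq_of_mem_Icc_inv_a_inv_mid {x : ℝ}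
    (hx : x ∈ Set.Icc (1 / 1.715 : ℝ) (2 / 2.715)) :
    Fpw x = 96 / 143 * 1.715 - 96 / 143 * x⁻¹ := by
  obtain ⟨h₁, h₂⟩ := hx
  obtain rfl | h₂ := h₂.eq_or_lt
  · norm_num [Fpw]
  · have h₃ : x < (2 : ℝ) / (1.715 + 1) := by norm_num at h₂ ⊢; exact h₂
    have h₄ : x < 1 := h₂.trans (by norm_num)
    rw [one_div] at h₁
    simp only [Fpw, one_div, show (1.715 : ℝ) - 1 = 143 / 200 by norm_num]
    split_ifs <;> linarith

/-- If `f` is affine with nonpositive intercept on a set of positive reals, then `f x / x` is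
monotone there. -/
theorem monotoneOn_div_of_eq_affine {f : ℝ → ℝ} {s : Set ℝ} {c d : ℝ} (hs : ∀ x ∈ s, 0 < x)
    (hd : 0 ≤ d) (hf : ∀ x ∈ s, f x = c * x + -d) : MonotoneOn (fun x => f x / x) s := by
  intro x hx y hy hxy
  have hx₀ := hs x hx
  have hy₀ := hs y hy
  simp only [hf x hx, hf y hy]
  rw [div_le_div_iff₀ hx₀ hy₀]
  nlinarith [mul_le_mul_of_nonneg_left hxy hd]

/-- If `f` is affine in `x⁻¹`, say `f x = p - q * x⁻¹`, on a set of positive reals where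
`p * x ≤ 2 * q`, then `f x / x` is monotone there. -/
theorem monotoneOn_div_of_eq_affine_inv {f : ℝ → ℝ} {s : Set ℝ} {p q : ℝ}
    (hs : ∀ x ∈ s, 0 < x) (hpq : ∀ x ∈ s, p * x ≤ 2 * q)
    (hf : ∀ x ∈ s, f x = p - q * x⁻¹) : MonotoneOn (fun x => f x / x) s := by
  have key : ∀ x ∈ s, p ≤ 2 * q * x⁻¹ := fun x hx => by
    rw [← div_eq_mul_inv, le_div_iff₀ (hs x hx)]
    exact hpq x hx
  intro x hx y hy hxy
  have hinv : y⁻¹ ≤ x⁻¹ := inv_anti₀ (hs x hx) hxy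
  simp only [hf x hx, hf y hy, div_eq_mul_inv]
  nlinarith [mul_nonneg (sub_nonneg.2 hinv)
    (add_nonneg (sub_nonneg.2 (key x hx)) (sub_nonneg.2 (key y hy)))]

/-- The function x ↦ F(x)/x is nondecreasing on [1/a, a] for a = 1.715. -/
theorem Fpw_div_monotone :
    MonotoneOn (fun x : ℝ => Fpw x / x) (Set.Icc ((1 : ℝ) / 1.715) 1.715) := by
  have h₁ : MonotoneOn (fun x : ℝ => Fpw x / x) (Set.Icc (1 / 1.715) (2 / 2.715)) :=
    monotoneOn_div_of_eq_affine_inv (fun x hx => lt_of_lt_of_le (by norm_num) hx.1)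
      (fun x hx => by have := hx.2; norm_num at this ⊢; linarith)
      (fun x hx => Fpw_eq_of_mem_Icc_inv_a_inv_mid hx)
  have h₂ : MonotoneOn (fun x : ℝ => Fpw x / x) (Set.Icc (2 / 2.715) 1) :=
    monotoneOn_div_of_eq_affine_inv (fun x hx => lt_of_lt_of_le (by norm_num) hx.1)
      (fun x hx => by linarith [hx.2]) (fun x hx => Fpw_eq_of_mem_Icc_inv_mid_one hx)
  have h₃ : MonotoneOn (fun x : ℝ => Fpw x / x) (Set.Icc 1 (2.715 / 2)) :=
    monotoneOn_div_of_eq_affine (fun x hx => lt_of_lt_of_le (by norm_num) hx.1)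
      (by norm_num) (fun x hx => Fpw_eq_of_mem_Icc_one_mid hx)
  have h₄ : MonotoneOn (fun x : ℝ => Fpw x / x) (Set.Icc (2.715 / 2) 1.715) :=
    monotoneOn_div_of_eq_affine (fun x hx => lt_of_lt_of_le (by norm_num) hx.1)
      (by norm_num) (fun x hx => Fpw_eq_of_mem_Icc_mid_a hx)
  have glue : ∀ {u v w : ℝ}, u ≤ v → v ≤ w →
      MonotoneOn (fun x : ℝ => Fpw x / x) (Set.Icc u v) →
      MonotoneOn (fun x : ℝ => Fpw x / x) (Set.Icc v w) →
      MonotoneOn (fun x : ℝ => Fpw x / x) (Set.Icc u w) := fun huv hvw h h' => by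
    rw [← Set.Icc_union_Icc_eq_Icc huv hvw]
    exact h.union_right h' (isGreatest_Icc huv) (isLeast_Icc hvw)
  exact glue (by norm_num) (by norm_num)
    (glue (by norm_num) (by norm_num) (glue (by norm_num) (by norm_num) h₁ h₂) h₃) h₄
end
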